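/- Let G be a simple graph on a finite vertex set V in which every vertex has degree at most 3. Then there exist a natural number N and ε₀ ∈ (0, 1) such that for all natural numbers n ≥ N and all ε ∈ (ε₀, 1): if V* ⊆ V is a maximum independent set of G, then R^s(V*, n, ε) ≥ R^s(Ṽ, n, ε) for every subset Ṽ ⊆ V. -/

import Mathlib

open Filter Topology

/-- The number `N_Ṽ(v)` of vertices of `Ṽ` adjacent to `v`. -/
def numAdj {V : Type*} [DecidableEq V] (G : SimpleGraph V) [DecidableRel G.Adj]
    (T : Finset V) (v : V) : ℕ :=
  (T.filter (fun u => G.Adj v u)).card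

/-- The sum rate `R^s(Ṽ, n, ε) = ∑_{v ∈ Ṽ} log₂(1 + n/(1 + N_Ṽ(v)·ε·n))`. -/
noncomputable def sumRate {V : Type*} [DecidableEq V] (G : SimpleGraph V) [DecidableRel G.Adj]
    (T : Finset V) (n : ℕ) (ε : ℝ) : ℝ :=
  ∑ v ∈ T, Real.logb 2 (1 + (n : ℝ) / (1 + (numAdj G T v : ℝ) * ε * n))

/-- `Ṽ` is an independent set of `G`: no two of its vertices are adjacent. -/
def IsIndepSet {V : Type*} (G : SimpleGraph V) (T : Finset V) : Prop :=
  ∀ u ∈ T, ∀ w ∈ T, ¬ G.Adj u w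

/-- `Ṽ` is a maximum independent set of `G`: an independent set of maximum cardinality. -/
def IsMaxIndepSet {V : Type*} (G : SimpleGraph V) (T : Finset V) : Prop :=
  IsIndepSet G T ∧ ∀ W : Finset V, IsIndepSet G W → W.card ≤ T.card

/-- If `N_T(v) = 0` then no vertex of `T` is adjacent to `v`. -/
theorem not_adj_of_numAdj_eq_zero {V : Type*} [DecidableEq V] {G : SimpleGraph V}
    [DecidableRel G.Adj] {T : Finset V} {v u : V} (h : numAdj G T v = 0) (hu : u ∈ T) :
    ¬ G.Adj v u := by
  rw [numAdj, Finset.card_eq_zero, Finset.filter_eq_empty_iff] at h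
  exact h hu

theorem IsIndepSet.numAdj_eq_zero {V : Type*} [DecidableEq V] {G : SimpleGraph V}
    [DecidableRel G.Adj] {T : Finset V} (h : IsIndepSet G T) {v : V} (hv : v ∈ T) :
    numAdj G T v = 0 := by
  rw [numAdj, Finset.card_eq_zero, Finset.filter_eq_empty_iff]
  exact fun u hu => h v hv u hu

theorem sumRate_eq_of_numAdj_eq_zero {V : Type*} [DecidableEq V] {G : SimpleGraph V}
    [DecidableRel G.Adj] {T : Finset V} (h : ∀ v ∈ T, numAdj G T v = 0) (n : ℕ) (ε : ℝ) :
    sumRate G T n ε = T.card * Real.logb 2 (1 + n) := by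
  rw [sumRate, Finset.sum_congr rfl fun v hv => by rw [h v hv], Finset.sum_const]
  simp

/-- A vertex with at least one interfering neighbour has rate at most `2` once `ε ≥ 1/2`. -/
theorem logb_rate_le_two {n k : ℕ} {ε : ℝ} (hε : 1 / 2 ≤ ε) (hk : k ≠ 0) :
    Real.logb 2 (1 + (n : ℝ) / (1 + (k : ℝ) * ε * n)) ≤ 2 := by
  have hk1 : (1 : ℝ) ≤ k := by exact_mod_cast Nat.one_le_iff_ne_zero.mpr hk
  have hn : (0 : ℝ) ≤ n := n.cast_nonneg
  have hkε : 1 / 2 ≤ (k : ℝ) * ε := by nlinarith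
  have hkn : 1 / 2 * (n : ℝ) ≤ (k : ℝ) * ε * n := mul_le_mul_of_nonneg_right hkε hn
  have hpos : 0 < 1 + (k : ℝ) * ε * n := by linarith
  have hfrac : (n : ℝ) / (1 + (k : ℝ) * ε * n) ≤ 3 := by
    rw [div_le_iff₀ hpos]
    linarith
  have hnonneg : 0 ≤ (n : ℝ) / (1 + (k : ℝ) * ε * n) := by positivity
  rw [Real.logb_le_iff_le_rpow (by norm_num) (by linarith)]
  norm_num
  linarith

/-- The sum rate is at most `log₂ (1 + n)` per isolated vertex of the induced subgraph plus `2`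
per remaining vertex. -/
theorem sumRate_le {V : Type*} [DecidableEq V] (G : SimpleGraph V) [DecidableRel G.Adj]
    (T : Finset V) (n : ℕ) {ε : ℝ} (hε : 1 / 2 ≤ ε) :
    sumRate G T n ε ≤ (T.filter (fun v => numAdj G T v = 0)).card * Real.logb 2 (1 + n)
      + T.card * 2 := by
  rw [sumRate, ← Finset.sum_filter_add_sum_filter_not T (fun v => numAdj G T v = 0)]
  refine add_le_add (le_of_eq ?_) ?_
  · rw [Finset.sum_congr rfl fun v hv => by rw [(Finset.mem_filter.mp hv).2], Finset.sum_const]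
    simp
  · refine (Finset.sum_le_card_nsmul _ _ 2 fun v hv =>
      logb_rate_le_two hε (Finset.mem_filter.mp hv).2).trans ?_
    rw [nsmul_eq_mul]
    have : (T.filter (fun v => ¬ numAdj G T v = 0)).card ≤ T.card := Finset.card_filter_le _ _
    gcongr

/-- Adding any one vertex of `T` to the isolated vertices of the subgraph induced on `T` yields
an independent set. -/
theorem isIndepSet_insert_filter {V : Type*} [DecidableEq V] (G : SimpleGraph V)
    [DecidableRel G.Adj] {T : Finset V} {v : V} (hv : v ∈ T) :
    IsIndepSet G (insert v (T.filter (fun u => numAdj G T u = 0))) := by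
  intro a ha b hb
  rw [Finset.mem_insert, Finset.mem_filter] at ha hb
  rcases ha with rfl | ⟨_, ha⟩
  · rcases hb with rfl | ⟨_, hb⟩
    · exact G.irrefl
    · exact fun h => not_adj_of_numAdj_eq_zero hb hv h.symm
  · refine not_adj_of_numAdj_eq_zero ha ?_
    rcases hb with rfl | ⟨hb, _⟩ <;> assumption

/-- If every vertex of `G` has degree at most 3, then for all sufficiently large `n` and all
`ε` sufficiently close to (and below) 1, every maximum independent set of `G` maximizes the
sum rate over all subsets of `V`. -/
theorem maxIndepSet_maximizes_sumRate {V : Type*} [Fintype V] [DecidableEq V]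
    (G : SimpleGraph V) [DecidableRel G.Adj] (hdeg : ∀ v : V, G.degree v ≤ 3) :
    ∃ N : ℕ, ∃ ε₀ ∈ Set.Ioo (0 : ℝ) 1,
      ∀ n : ℕ, N ≤ n → ∀ ε ∈ Set.Ioo ε₀ (1 : ℝ),
        ∀ Vstar : Finset V, IsMaxIndepSet G Vstar →
          ∀ T : Finset V, sumRate G T n ε ≤ sumRate G Vstar n ε := by
  refine ⟨4 ^ Fintype.card V, 1 / 2, by norm_num, fun n hn ε hε S hS T => ?_⟩
  rw [sumRate_eq_of_numAdj_eq_zero fun v hv => hS.1.numAdj_eq_zero hv]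
  have hlog : (Fintype.card V : ℝ) * 2 ≤ Real.logb 2 (1 + n) := by
    rw [Real.le_logb_iff_rpow_le (by norm_num) (by positivity)]
    have hpow : (2 : ℝ) ^ ((Fintype.card V : ℝ) * 2) = 4 ^ Fintype.card V := by
      rw [mul_comm, Real.rpow_mul (by norm_num), Real.rpow_natCast]
      norm_num
    have hn' : (4 : ℝ) ^ Fintype.card V ≤ n := by exact_mod_cast hn
    linarith
  have hlog0 : 0 ≤ Real.logb 2 (1 + (n : ℝ)) := le_trans (by positivity) hlog
  by_cases hT : ∀ v ∈ T, numAdj G T v = 0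
  · rw [sumRate_eq_of_numAdj_eq_zero hT]
    have hcard : T.card ≤ S.card :=
      hS.2 T fun u hu w hw => not_adj_of_numAdj_eq_zero (hT u hu) hw
    gcongr
  · push Not at hT
    obtain ⟨v, hv, hvT⟩ := hT
    have hcard := hS.2 _ (isIndepSet_insert_filter G hv)
    rw [Finset.card_insert_of_notMem (by simp [hvT])] at hcard
    have hcard' : ((T.filter (fun u => numAdj G T u = 0)).card : ℝ) + 1 ≤ S.card := by
      exact_mod_cast hcard
    have hTV : (T.card : ℝ) ≤ Fintype.card V := by exact_mod_cast T.card_le_univ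
    have hmul := mul_le_mul_of_nonneg_right hcard' hlog0
    linarith [sumRate_le G T n hε.1.le]
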